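/- arXiv:2110.03364 — 5 statements merged into one kernel-verified Lean document; each statement's English description precedes it below -/
import Mathlib

section
/- The strong-convexity inequality holds in all directions if and only if the slope bound holds; precisely: ( for every nonzero v ∈ ℝ², (a + h)·α(v) + 2h·β(v) > 0 ) if and only if 2·s < (a + h)/h. -/
/-- A directional slope is at most the sine of the slant angle times the arc-length factor. -/
lemma abs_slope_le_sin_slant_mul (gx gy x y : ℝ) :
    |x * gx + y * gy| ≤ √(gx ^ 2 + gy ^ 2) / √(1 + gx ^ 2 + gy ^ 2) *
      √(x ^ 2 + y ^ 2 + (x * gx + y * gy) ^ 2) := by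
  have hK : 0 < 1 + gx ^ 2 + gy ^ 2 := by positivity
  rw [div_mul_eq_mul_div, le_div_iff₀ (Real.sqrt_pos.2 hK), ← Real.sqrt_mul (by positivity),
    ← Real.sqrt_sq_eq_abs, ← Real.sqrt_mul (sq_nonneg _)]
  apply Real.sqrt_le_sqrt
  nlinarith [sq_nonneg (x * gy - y * gx)]

/-- In the downhill direction `-(gx, gy)` the arc-length factor splits as a product. -/
lemma sqrt_arcLength_downhill (gx gy : ℝ) :
    √((-gx) ^ 2 + (-gy) ^ 2 + (-gx * gx + -gy * gy) ^ 2) =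
      √(gx ^ 2 + gy ^ 2) * √(1 + gx ^ 2 + gy ^ 2) := by
  rw [← Real.sqrt_mul (by positivity)]
  congr 1
  ring


/-- the strong-convexity inequality `(a+h)·α v + 2h·β v > 0` holds in all
(nonzero) directions if and only if the slope bound `2s < (a+h)/h` holds. -/
theorem strong_convexity_iff_slope_bound
    (gx gy a h : ℝ) (ha : 0 < a) (hh : 0 < h)
    (β α : ℝ × ℝ → ℝ) (s : ℝ)
    (hβ : ∀ v : ℝ × ℝ, β v = v.1 * gx + v.2 * gy)
    (hα : ∀ v : ℝ × ℝ, α v = Real.sqrt (v.1 ^ 2 + v.2 ^ 2 + β v ^ 2))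
    (hs : s = Real.sqrt (gx ^ 2 + gy ^ 2) / Real.sqrt (1 + gx ^ 2 + gy ^ 2)) :
    (∀ v : ℝ × ℝ, v ≠ 0 → 0 < (a + h) * α v + 2 * h * β v) ↔
      2 * s < (a + h) / h := by
  have hK : 0 < √(1 + gx ^ 2 + gy ^ 2) := Real.sqrt_pos.2 (by positivity)
  rw [lt_div_iff₀ hh]
  constructor
  · intro H
    rcases (Real.sqrt_nonneg (gx ^ 2 + gy ^ 2)).eq_or_lt with hG | hG
    · rw [hs, ← hG]
      simp only [zero_div, mul_zero, zero_mul]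
      positivity
    · have hv : ((-gx, -gy) : ℝ × ℝ) ≠ 0 := by
        intro h0
        obtain ⟨hx, hy⟩ := Prod.mk.inj h0
        simp [neg_eq_zero.1 hx, neg_eq_zero.1 hy] at hG
      have hdown := H _ hv
      simp only [hα, hβ, sqrt_arcLength_downhill] at hdown
      have hsq : √(gx ^ 2 + gy ^ 2) ^ 2 = gx ^ 2 + gy ^ 2 := Real.sq_sqrt (by positivity)
      have hpos : 0 < √(gx ^ 2 + gy ^ 2) *
          ((a + h) * √(1 + gx ^ 2 + gy ^ 2) - 2 * h * √(gx ^ 2 + gy ^ 2)) := by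
        linear_combination hdown + 2 * h * hsq
      have hlt := pos_of_mul_pos_right hpos hG.le
      rw [hs, mul_div_assoc', div_mul_eq_mul_div, div_lt_iff₀ hK]
      linarith
  · intro H v hv
    have hαpos : 0 < α v := by
      rw [hα]
      apply Real.sqrt_pos.2
      by_contra! hle
      refine hv (Prod.ext ?_ ?_) <;> simp only [Prod.fst_zero, Prod.snd_zero] <;>
        nlinarith [sq_nonneg v.1, sq_nonneg v.2, sq_nonneg (β v)]
    have hslope : -β v ≤ s * α v := by
      rw [hα, hβ, hs]
      exact (neg_le_abs _).trans (abs_slope_le_sin_slant_mul gx gy v.1 v.2)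
    nlinarith [mul_lt_mul_of_pos_right H hαpos, mul_le_mul_of_nonneg_left hslope hh.le]
end

section
/- (Proposition 3.4, pointwise form.) The function F is a Minkowski norm on ℝ² if and only if 2·s < (a + h)/h. -/
/-- A Minkowski norm on `ℝ²`: continuous, nonnegative, positive and infinitely
differentiable away from the origin, positively 1-homogeneous, and for every `v ≠ 0`
the fundamental tensor `g_v(u,w) := (1/2)·(D² N²)(v)[u,w]` is a positive definite
symmetric bilinear form. -/
def IsMinkowskiNorm (N : ℝ × ℝ → ℝ) : Prop :=
  Continuous N ∧
  (∀ v : ℝ × ℝ, 0 ≤ N v) ∧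
  (∀ v : ℝ × ℝ, v ≠ 0 → 0 < N v) ∧
  ContDiffOn ℝ (⊤ : ℕ∞) N {(0 : ℝ × ℝ)}ᶜ ∧
  (∀ lam : ℝ, 0 < lam → ∀ v : ℝ × ℝ, N (lam • v) = lam * N v) ∧
  (∀ v : ℝ × ℝ, v ≠ 0 →
    (∀ u w : ℝ × ℝ,
      (1 / 2 : ℝ) * iteratedFDeriv ℝ 2 (fun x => N x ^ 2) v ![u, w] =
        (1 / 2 : ℝ) * iteratedFDeriv ℝ 2 (fun x => N x ^ 2) v ![w, u]) ∧
    (∀ u : ℝ × ℝ, u ≠ 0 →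
      0 < (1 / 2 : ℝ) * iteratedFDeriv ℝ 2 (fun x => N x ^ 2) v ![u, u]))

open Filter Topology

/-- The Hessian of `N ^ 2` in a direction `u`, from the derivatives of `N` along the line
through `v` with direction `u`. -/
lemma iteratedFDeriv_two_sq_apply_self {E : Type*} [NormedAddCommGroup E] [NormedSpace ℝ E]
    {N : E → ℝ} {v u : E} (hN : ContDiffAt ℝ 2 N v) {d : ℝ → ℝ} {d' : ℝ}
    (hd : ∀ᶠ t in 𝓝 (0 : ℝ), HasDerivAt (fun t => N (v + t • u)) (d t) t)
    (hd' : HasDerivAt d d' 0) :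
    iteratedFDeriv ℝ 2 (fun x => N x ^ 2) v ![u, u] = 2 * (d 0 ^ 2 + N v * d') := by
  set f : E → ℝ := fun x => N x ^ 2
  have hf : ContDiffAt ℝ 2 f v := hN.pow 2
  have hline : ∀ t : ℝ, HasDerivAt (fun t : ℝ => v + t • u) u t := fun t => by
    simpa using ((hasDerivAt_id t).smul_const u).const_add v
  have hline0 : v + (0 : ℝ) • u = v := by simp
  have hdf : ∀ᶠ t in 𝓝 (0 : ℝ), DifferentiableAt ℝ f (v + t • u) := by
    have h1 : ∀ᶠ x in 𝓝 v, ContDiffAt ℝ 2 f x := hf.eventually (by simp)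
    have h2 : Tendsto (fun t : ℝ => v + t • u) (𝓝 0) (𝓝 v) := by
      simpa using (hline 0).continuousAt.tendsto
    filter_upwards [h2.eventually h1] with t ht
    exact ht.differentiableAt two_ne_zero
  have hfd : HasFDerivAt (fderiv ℝ f) (fderiv ℝ (fderiv ℝ f) v) (v + (0 : ℝ) • u) := by
    rw [hline0]
    exact ((hf.fderiv_right (m := 1) one_add_one_eq_two.le).differentiableAt one_ne_zero).hasFDerivAt
  have hsecond : HasDerivAt (fun t : ℝ => fderiv ℝ f (v + t • u) u)
      (fderiv ℝ (fderiv ℝ f) v u u) 0 := by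
    have h1 : HasDerivAt (fun t : ℝ => fderiv ℝ f (v + t • u)) (fderiv ℝ (fderiv ℝ f) v u) 0 :=
      hfd.comp_hasDerivAt 0 (hline 0)
    exact ((ContinuousLinearMap.apply ℝ ℝ u).hasFDerivAt.comp_hasDerivAt 0 h1 :)
  have hN0 : HasDerivAt (fun t : ℝ => N (v + t • u)) (d 0) 0 := hd.self_of_nhds
  have hprod : HasDerivAt (fun t => 2 * (N (v + t • u) * d t))
      (2 * (d 0 ^ 2 + N v * d')) 0 := by
    refine ((hN0.mul hd').const_mul 2).congr_deriv ?_
    rw [hline0]; ring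
  have heq : (fun t : ℝ => fderiv ℝ f (v + t • u) u) =ᶠ[𝓝 0]
      fun t => 2 * (N (v + t • u) * d t) := by
    filter_upwards [hd, hdf] with t ht ht'
    have h1 := ht'.hasFDerivAt.comp_hasDerivAt t (hline t)
    have h2 := ht.pow 2
    refine (h1.unique h2).trans ?_
    simp; ring
  rw [iteratedFDeriv_two_apply]
  exact hsecond.unique (hprod.congr_of_eventuallyEq heq)

/-- First and second derivative at `0` of `Q / (c √Q + h ℓ)` for a quadratic polynomial `Q`
and an affine function `ℓ`. -/
lemma exists_hasDerivAt_quadratic_div {A B C b e c h : ℝ} (hA : 0 < A)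
    (hD : 0 < c * √A + h * b) :
    ∃ (d : ℝ → ℝ) (d' : ℝ),
      (∀ᶠ t in 𝓝 (0 : ℝ), HasDerivAt (fun t : ℝ => (A + 2 * B * t + C * t ^ 2) /
        (c * √(A + 2 * B * t + C * t ^ 2) + h * (b + e * t))) (d t) t) ∧
      HasDerivAt d d' 0 ∧
      d 0 * (c * √A + h * b) ^ 2 = B * (c * √A + h * b) - h * (A * e - B * b) ∧
      d' * (A * (c * √A + h * b) ^ 3) =
        (A * C - B ^ 2) * (c * √A + h * b) * (c * √A + 2 * h * b) +
          2 * h ^ 2 * (A * e - B * b) ^ 2 := by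
  set Q : ℝ → ℝ := fun t => A + 2 * B * t + C * t ^ 2 with hQdef
  set Q₁ : ℝ → ℝ := fun t => 2 * B + 2 * C * t with hQ₁def
  set D : ℝ → ℝ := fun t => c * √(Q t) + h * (b + e * t) with hDdef
  set D₁ : ℝ → ℝ := fun t => c * (Q₁ t / (2 * √(Q t))) + h * e with hD₁def
  have hQ0 : Q 0 = A := by simp [Q]
  have hQ₁0 : Q₁ 0 = 2 * B := by simp [Q₁]
  have hD0 : D 0 = c * √A + h * b := by simp [D, hQ0]
  have hp : 0 < √A := Real.sqrt_pos.2 hA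
  have hpp : √A ^ 2 = A := Real.sq_sqrt hA.le
  have hQ : ∀ t, HasDerivAt Q (Q₁ t) t := fun t => by
    refine ((((hasDerivAt_id' t).const_mul (2 * B)).const_add A).add
      ((hasDerivAt_pow 2 t).const_mul C)).congr_deriv ?_
    simp [Q₁]; ring
  have hQ₁ : ∀ t, HasDerivAt Q₁ (2 * C) t := fun t => by
    refine (((hasDerivAt_id' t).const_mul (2 * C)).const_add (2 * B)).congr_deriv ?_
    simp
  have hDd : ∀ t, Q t ≠ 0 → HasDerivAt D (D₁ t) t := fun t ht => by
    refine (((hQ t).sqrt ht).const_mul c).add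
      ((((hasDerivAt_id' t).const_mul e).const_add b).const_mul h) |>.congr_deriv ?_
    simp [D₁]
  have hQA : Q 0 ≠ 0 := by rw [hQ0]; exact hA.ne'
  have hDA : D 0 ≠ 0 := by rw [hD0]; exact hD.ne'
  have hD₁d := (((hQ₁ 0).div (((hQ 0).sqrt hQA).const_mul 2)
    (by rw [hQ0]; positivity)).const_mul c).add_const (h * e)
  have hd := (((hQ₁ 0).mul (hDd 0 hQA)).sub ((hQ 0).mul hD₁d)).div ((hDd 0 hQA).pow 2)
    (pow_ne_zero 2 hDA)
  refine ⟨fun t => (Q₁ t * D t - Q t * D₁ t) / D t ^ 2, _, ?_, hd, ?_, ?_⟩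
  · filter_upwards [(hQ 0).continuousAt.eventually_ne hQA,
      (hDd 0 hQA).continuousAt.eventually_ne hDA] with t h1 h2
    exact (hQ t).div (hDd t h1) h2
  · simp only [hD₁def, hD0, hQ0, hQ₁0]
    generalize √A = p at *
    subst hpp
    field_simp
    ring
  · simp only [Pi.mul_apply, Pi.sub_apply, Pi.div_apply, Pi.pow_apply, hD₁def, hD0, hQ0, hQ₁0]
    generalize √A = p at *
    subst hpp
    field_simp
    ring

/-- Proposition 3.4, pointwise form: `F` is a Minkowski norm on `ℝ²`
if and only if `2s < (a+h)/h`. -/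
theorem matsumoto_minkowski_iff_slope_bound
    (gx gy a h : ℝ) (ha : 0 < a) (hh : 0 < h)
    (β α F : ℝ × ℝ → ℝ) (s : ℝ)
    (hβ : ∀ v : ℝ × ℝ, β v = v.1 * gx + v.2 * gy)
    (hα : ∀ v : ℝ × ℝ, α v = Real.sqrt (v.1 ^ 2 + v.2 ^ 2 + β v ^ 2))
    (hF : ∀ v : ℝ × ℝ, v ≠ 0 → F v = α v ^ 2 / (a * α v + h * (α v + β v)))
    (hF0 : F 0 = 0)
    (hs : s = Real.sqrt (gx ^ 2 + gy ^ 2) / Real.sqrt (1 + gx ^ 2 + gy ^ 2)) :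
    IsMinkowskiNorm F ↔ 2 * s < (a + h) / h := by
  have hq : 0 ≤ gx ^ 2 + gy ^ 2 := by positivity
  have hq1 : 0 < 1 + gx ^ 2 + gy ^ 2 := by positivity
  have hs0 : 0 ≤ s := by rw [hs]; positivity
  have hs2 : s ^ 2 * (1 + gx ^ 2 + gy ^ 2) = gx ^ 2 + gy ^ 2 := by
    rw [hs, div_pow, Real.sq_sqrt hq, Real.sq_sqrt hq1.le, div_mul_cancel₀ _ hq1.ne']
  have hs1 : s < 1 := by
    by_contra! h1
    nlinarith [mul_le_mul_of_nonneg_right (one_le_pow₀ h1 (n := 2)) hq1.le]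
  have hahs : 0 < a + h - h * s := by linarith [mul_pos hh (sub_pos.2 hs1)]
  have hcond : 2 * s < (a + h) / h ↔ 2 * s * h < a + h := lt_div_iff₀ hh
  have hα0 : ∀ v, 0 ≤ α v := fun v => by rw [hα]; exact Real.sqrt_nonneg _
  have hα2 : ∀ v, α v ^ 2 = v.1 ^ 2 + v.2 ^ 2 + β v ^ 2 := fun v => by
    rw [hα]; exact Real.sq_sqrt (by positivity)
  have hβα : ∀ v, -(s * α v) ≤ β v := fun v => by
    refine (abs_le_of_sq_le_sq' ?_ (mul_nonneg hs0 (hα0 v))).1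
    refine le_of_mul_le_mul_right ?_ hq1
    have : (s * α v) ^ 2 * (1 + gx ^ 2 + gy ^ 2) = (gx ^ 2 + gy ^ 2) * α v ^ 2 := by
      rw [← hs2]; ring
    rw [this, hα2, hβ]
    nlinarith [sq_nonneg (v.1 * gy - v.2 * gx)]
  have hαpos : ∀ v, v ≠ 0 → 0 < α v := fun v hv => by
    refine (hα0 v).lt_of_ne' fun h0 => hv ?_
    have h1 := hα2 v
    rw [h0] at h1
    have h2 : v.1 = 0 := by nlinarith [sq_nonneg v.1, sq_nonneg v.2, sq_nonneg (β v)]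
    have h3 : v.2 = 0 := by nlinarith [sq_nonneg v.1, sq_nonneg v.2, sq_nonneg (β v)]
    exact Prod.ext h2 h3
  have hβ0 : β 0 = 0 := by simp [hβ]
  have hαz : α 0 = 0 := by simp [hα, hβ0]
  have hFv : ∀ v, F v = α v ^ 2 / ((a + h) * α v + h * β v) := fun v => by
    rcases eq_or_ne v 0 with rfl | hv
    · simp [hF0, hαz]
    · rw [hF v hv]; ring_nf
  have hden : ∀ v, a * α v ≤ (a + h) * α v + h * β v := fun v => by
    nlinarith [hβα v, hα0 v, mul_nonneg hh.le (mul_nonneg (sub_nonneg.2 hs1.le) (hα0 v))]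
  have hdenpos : ∀ v, v ≠ 0 → 0 < (a + h) * α v + h * β v := fun v hv =>
    (mul_pos ha (hαpos v hv)).trans_le (hden v)
  have hFpos : ∀ v, v ≠ 0 → 0 < F v := fun v hv => by
    rw [hFv]; exact div_pos (pow_pos (hαpos v hv) 2) (hdenpos v hv)
  have hβs : ContDiff ℝ (⊤ : ℕ∞) β := by
    rw [funext hβ]; fun_prop
  have hαs : ∀ v, v ≠ 0 → ContDiffAt ℝ (⊤ : ℕ∞) α v := fun v hv => by
    rw [funext hα]
    refine ContDiffAt.sqrt (by fun_prop) ?_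
    rw [← hα2]
    exact pow_ne_zero 2 (hαpos v hv).ne'
  have hFs : ∀ v, v ≠ 0 → ContDiffAt ℝ (⊤ : ℕ∞) F v := fun v hv => by
    rw [funext hFv]
    exact ((hαs v hv).pow 2).div
      ((contDiffAt_const.mul (hαs v hv)).add (contDiffAt_const.mul hβs.contDiffAt))
      (hdenpos v hv).ne'
  have hFs2 : ∀ v, v ≠ 0 → ContDiffAt ℝ 2 F v := fun v hv =>
    (hFs v hv).of_le (WithTop.coe_le_coe.2 le_top)
  have hαc : Continuous α := by
    have := hβs.continuous
    rw [funext hα]; fun_prop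
  have hFc : Continuous F := by
    refine continuous_iff_continuousAt.2 fun v => ?_
    rcases eq_or_ne v 0 with rfl | hv
    · have hle : ∀ v, F v ≤ α v / a := fun v => by
        rcases eq_or_ne v 0 with rfl | hv
        · simp [hF0, hαz]
        · rw [hFv, div_le_div_iff₀ (hdenpos v hv) ha]
          nlinarith [hden v, hα0 v]
      have hnn : ∀ v, 0 ≤ F v := fun v => by
        rcases eq_or_ne v 0 with rfl | hv
        · exact hF0.ge
        · exact (hFpos v hv).le
      have hlim : Tendsto (fun v => α v / a) (𝓝 0) (𝓝 0) := by
        simpa [hαz] using (hαc.div_const a).tendsto 0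
      rw [ContinuousAt, hF0]
      exact squeeze_zero hnn hle hlim
    · exact (hFs v hv).continuousAt
  have hhom : ∀ lam : ℝ, 0 < lam → ∀ v : ℝ × ℝ, F (lam • v) = lam * F v := fun lam hl v => by
    have h1 : β (lam • v) = lam * β v := by simp [hβ]; ring
    have h2 : α (lam • v) = lam * α v := by
      rw [← abs_of_nonneg (hα0 (lam • v)), ← abs_of_nonneg (mul_nonneg hl.le (hα0 v)),
        ← sq_eq_sq_iff_abs_eq_abs, mul_pow, hα2, hα2, h1]
      simp; ring
    rcases eq_or_ne v 0 with rfl | hv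
    · simp [hF0]
    · have := (hdenpos v hv).ne'
      rw [hFv, hFv, h1, h2, show (a + h) * (lam * α v) + h * (lam * β v) =
        lam * ((a + h) * α v + h * β v) by ring]
      field_simp
  have hHess : ∀ v u : ℝ × ℝ, v ≠ 0 → ∃ d d' : ℝ,
      iteratedFDeriv ℝ 2 (fun x => F x ^ 2) v ![u, u] = 2 * (d ^ 2 + F v * d') ∧
      d * ((a + h) * α v + h * β v) ^ 2 =
        (v.1 * u.1 + v.2 * u.2 + β v * β u) * ((a + h) * α v + h * β v) -
          h * (α v ^ 2 * β u - (v.1 * u.1 + v.2 * u.2 + β v * β u) * β v) ∧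
      d' * (α v * ((a + h) * α v + h * β v) ^ 3) =
        (1 + gx ^ 2 + gy ^ 2) * (v.1 * u.2 - v.2 * u.1) ^ 2 *
          ((a + h) ^ 2 * α v + 3 * (a + h) * h * β v + 2 * h ^ 2 * s ^ 2 * α v) := fun v u hv => by
    have hA := pow_pos (hαpos v hv) 2
    have hsq := Real.sqrt_sq (hα0 v)
    obtain ⟨d, d', hd, hd', h1, h2⟩ := exists_hasDerivAt_quadratic_div
      (B := v.1 * u.1 + v.2 * u.2 + β v * β u) (C := α u ^ 2) (b := β v) (e := β u)
      (c := a + h) (h := h) hA (by rw [hsq]; exact hdenpos v hv)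
    rw [hsq] at h1 h2
    refine ⟨d 0, d', iteratedFDeriv_two_sq_apply_self
      (hFs2 v hv) ?_ hd', h1, ?_⟩
    · convert hd using 4 with t t
      have h3 : β (v + t • u) = β v + β u * t := by simp [hβ]; ring
      have h4 : α (v + t • u) ^ 2 = α v ^ 2 + 2 * (v.1 * u.1 + v.2 * u.2 + β v * β u) * t +
          α u ^ 2 * t ^ 2 := by
        rw [hα2, hα2, hα2, h3]; simp; ring
      rw [hFv, ← h4, Real.sqrt_sq (hα0 _), h3]
    · have hΔ : α v ^ 2 * α u ^ 2 - (v.1 * u.1 + v.2 * u.2 + β v * β u) ^ 2 =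
          (1 + gx ^ 2 + gy ^ 2) * (v.1 * u.2 - v.2 * u.1) ^ 2 := by
        rw [hα2, hα2, hβ, hβ]; ring
      have hcross : (α v ^ 2 * β u - (v.1 * u.1 + v.2 * u.2 + β v * β u) * β v) ^ 2 =
          (1 + gx ^ 2 + gy ^ 2) * (v.1 * u.2 - v.2 * u.1) ^ 2 * (s ^ 2 * α v ^ 2 - β v ^ 2) := by
        have : (1 + gx ^ 2 + gy ^ 2) * (v.1 * u.2 - v.2 * u.1) ^ 2 *
            (s ^ 2 * α v ^ 2 - β v ^ 2) = (v.1 * u.2 - v.2 * u.1) ^ 2 *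
            (s ^ 2 * (1 + gx ^ 2 + gy ^ 2) * α v ^ 2 - (1 + gx ^ 2 + gy ^ 2) * β v ^ 2) := by ring
        rw [this, hs2, hα2, hβ, hβ]; ring
      rw [hΔ, hcross] at h2
      refine mul_right_cancel₀ (hαpos v hv).ne' ?_
      linear_combination h2
  rw [hcond]
  constructor
  · rintro ⟨-, -, -, -, -, hpos⟩
    by_cases hg : gx = 0 ∧ gy = 0
    · have : s = 0 := by rw [hs]; simp [hg.1, hg.2]
      rw [this]; linarith
    have hv : ((-gx, -gy) : ℝ × ℝ) ≠ 0 := fun h0 => hg (by simpa using h0)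
    have hu : ((-gy, gx) : ℝ × ℝ) ≠ 0 := fun h0 => hg (by simpa [and_comm] using h0)
    have hβv : β (-gx, -gy) = -(gx ^ 2 + gy ^ 2) := by rw [hβ]; ring
    have hβu : β (-gy, gx) = 0 := by rw [hβ]; ring
    have hβs' : β (-gx, -gy) = -(s * α (-gx, -gy)) := by
      have : s * α (-gx, -gy) = gx ^ 2 + gy ^ 2 := by
        rw [← sq_eq_sq₀ (mul_nonneg hs0 (hα0 _)) hq, mul_pow, hα2, hβv]
        linear_combination (gx ^ 2 + gy ^ 2) * hs2
      rw [hβv, this]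
    obtain ⟨d, d', h1, h2, h3⟩ := hHess (-gx, -gy) (-gy, gx) hv
    have hp := (hpos _ hv).2 _ hu
    have hD := hdenpos _ hv
    have hα' := hαpos _ hv
    have hd : d = 0 := by
      refine (mul_eq_zero.1 (h2.trans ?_)).resolve_right (pow_ne_zero 2 hD.ne')
      rw [hβu]; ring
    have hd' : 0 < d' := by
      rw [h1, hd] at hp
      refine pos_of_mul_pos_right (a := F (-gx, -gy)) ?_ (hFpos _ hv).le
      linarith
    have h4 := (mul_pos hd' (mul_pos hα' (pow_pos hD 3))).trans_eq h3
    have h5 := pos_of_mul_pos_right h4 (by positivity)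
    rw [hβs'] at h5
    have h6 : 0 < α (-gx, -gy) * ((a + h - h * s) * (a + h - 2 * s * h)) := by
      linarith
    linarith [pos_of_mul_pos_right (pos_of_mul_pos_right h6 hα'.le) hahs.le]
  · intro hlt
    refine ⟨hFc, fun v => ?_, hFpos, fun v hv => (hFs v hv).contDiffWithinAt, hhom,
      fun v hv => ⟨fun u w => ?_, fun u hu => ?_⟩⟩
    · rcases eq_or_ne v 0 with rfl | hv
      · exact hF0.ge
      · exact (hFpos v hv).le
    · have hsymm := ((hFs2 v hv).pow 2).isSymmSndFDerivAt (by simp)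
      rw [iteratedFDeriv_two_apply, iteratedFDeriv_two_apply]
      exact congrArg _ (hsymm.eq u w)
    · obtain ⟨d, d', h1, h2, h3⟩ := hHess v u hv
      have hD := hdenpos v hv
      have hα' := hαpos v hv
      rw [h1]
      rcases eq_or_ne (v.1 * u.2 - v.2 * u.1) 0 with h0 | h0
      · have hd' : d' = 0 := by
          refine (mul_eq_zero.1 (h3.trans ?_)).resolve_right (by positivity)
          rw [h0]; ring
        have hd : d ≠ 0 := by
          have hB : (v.1 * u.1 + v.2 * u.2 + β v * β u) ^ 2 = α v ^ 2 * α u ^ 2 := by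
            rw [hα2, hα2, hβ, hβ]
            linear_combination -(1 + gx ^ 2 + gy ^ 2) * (v.1 * u.2 - v.2 * u.1) * h0
          have hcross : α v ^ 2 * β u - (v.1 * u.1 + v.2 * u.2 + β v * β u) * β v = 0 := by
            rw [hα2, hβ, hβ]
            linear_combination (v.1 * gy - v.2 * gx) * h0
          rintro rfl
          rw [hcross, zero_mul, mul_zero, sub_zero] at h2
          rw [(mul_eq_zero.1 h2.symm).resolve_right hD.ne'] at hB
          have := mul_pos (pow_pos hα' 2) (pow_pos (hαpos u hu) 2)
          linarith
        rw [hd']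
        have := sq_pos_of_ne_zero hd
        linarith
      · have hd' : 0 < d' := by
          refine pos_of_mul_pos_left (b := α v * ((a + h) * α v + h * β v) ^ 3) ?_ (by positivity)
          rw [h3]
          have h7 : 0 < (a + h - h * s) * (a + h - 2 * s * h) :=
            mul_pos hahs (by linarith)
          have h8 := mul_pos hα' h7
          have h9 : 0 ≤ 3 * (a + h) * h * (β v + s * α v) :=
            mul_nonneg (by positivity) (by linarith [hβα v])
          exact mul_pos (by positivity) (by linarith)
        linarith [mul_pos (hFpos v hv) hd', sq_nonneg d]
end

section
/- (Persistence of the Finsler property for weak wind.) Suppose 2·s < (a + h)/h, where s := √(gₓ² + g_y²)/√(1 + gₓ² + g_y²). Then there exists ε₀ ∈ (0,1) such that for every ε ∈ [0, ε₀) and every φ̃ ∈ ℝ, one has α(v) − ε·ω(v) > 0 and D(v) > 0 for all nonzero v, and the function F_w (extended by F_w(0) := 0) is a Minkowski norm on ℝ². -/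
open Filter Topology

/-- The value, first and second derivative of `f` at `t` are `a₀`, `a₁`, `a₂`. -/
def HasTwoJetAt (f : ℝ → ℝ) (t a₀ a₁ a₂ : ℝ) : Prop :=
  f t = a₀ ∧ ∃ f' : ℝ → ℝ, (∀ᶠ r in 𝓝 t, HasDerivAt f (f' r) r) ∧ f' t = a₁ ∧ HasDerivAt f' a₂ t

namespace HasTwoJetAt

variable {f g : ℝ → ℝ} {t a₀ a₁ a₂ b₀ b₁ b₂ : ℝ}

theorem continuousAt (hf : HasTwoJetAt f t a₀ a₁ a₂) : ContinuousAt f t := by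
  obtain ⟨-, f', h, -, -⟩ := hf
  exact h.self_of_nhds.continuousAt

theorem congr_jet (hf : HasTwoJetAt f t a₀ a₁ a₂) (h₀ : a₀ = b₀) (h₁ : a₁ = b₁) (h₂ : a₂ = b₂) :
    HasTwoJetAt f t b₀ b₁ b₂ := by
  subst h₀ h₁ h₂
  exact hf

theorem congr_of_eventuallyEq (hf : HasTwoJetAt f t a₀ a₁ a₂) (h : g =ᶠ[𝓝 t] f) :
    HasTwoJetAt g t a₀ a₁ a₂ := by
  obtain ⟨rfl, f', hf', rfl, hf''⟩ := hf
  refine ⟨h.self_of_nhds, f', ?_, rfl, hf''⟩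
  filter_upwards [hf', h.eventuallyEq_nhds] with r h₁ h₂ using h₁.congr_of_eventuallyEq h₂

theorem quadratic (A B C : ℝ) :
    HasTwoJetAt (fun r => A + B * r + C * r ^ 2) 0 A B (2 * C) := by
  refine ⟨by simp, fun r => B + 2 * C * r, Eventually.of_forall fun r => ?_, by simp, ?_⟩
  · have h := (((hasDerivAt_id r).const_mul B).const_add A).add
      (((hasDerivAt_id r).pow 2).const_mul C)
    refine h.congr_deriv ?_
    simp
    ring
  · simpa using ((hasDerivAt_id (0 : ℝ)).const_mul (2 * C)).const_add B

theorem add (hf : HasTwoJetAt f t a₀ a₁ a₂) (hg : HasTwoJetAt g t b₀ b₁ b₂) :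
    HasTwoJetAt (fun r => f r + g r) t (a₀ + b₀) (a₁ + b₁) (a₂ + b₂) := by
  obtain ⟨rfl, f', hf', rfl, hf''⟩ := hf
  obtain ⟨rfl, g', hg', rfl, hg''⟩ := hg
  refine ⟨rfl, fun r => f' r + g' r, ?_, rfl, hf''.add hg''⟩
  filter_upwards [hf', hg'] with r h₁ h₂ using h₁.add h₂

theorem const_mul (c : ℝ) (hf : HasTwoJetAt f t a₀ a₁ a₂) :
    HasTwoJetAt (fun r => c * f r) t (c * a₀) (c * a₁) (c * a₂) := by
  obtain ⟨rfl, f', hf', rfl, hf''⟩ := hf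
  refine ⟨rfl, fun r => c * f' r, ?_, rfl, hf''.const_mul c⟩
  filter_upwards [hf'] with r h₁ using h₁.const_mul c

theorem mul (hf : HasTwoJetAt f t a₀ a₁ a₂) (hg : HasTwoJetAt g t b₀ b₁ b₂) :
    HasTwoJetAt (fun r => f r * g r) t (a₀ * b₀) (a₁ * b₀ + a₀ * b₁)
      (a₂ * b₀ + 2 * a₁ * b₁ + a₀ * b₂) := by
  obtain ⟨rfl, f', hf', rfl, hf''⟩ := hf
  obtain ⟨rfl, g', hg', rfl, hg''⟩ := hg
  refine ⟨rfl, fun r => f' r * g r + f r * g' r, ?_, rfl, ?_⟩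
  · filter_upwards [hf', hg'] with r h₁ h₂ using h₁.mul h₂
  · refine ((hf''.mul hg'.self_of_nhds).add (hf'.self_of_nhds.mul hg'')).congr_deriv ?_
    ring

theorem inv (hf : HasTwoJetAt f t a₀ a₁ a₂) (h₀ : a₀ ≠ 0) :
    HasTwoJetAt (fun r => (f r)⁻¹) t a₀⁻¹ (-a₁ / a₀ ^ 2)
      (2 * a₁ ^ 2 / a₀ ^ 3 - a₂ / a₀ ^ 2) := by
  have hc := hf.continuousAt
  obtain ⟨rfl, f', hf', rfl, hf''⟩ := hf
  refine ⟨rfl, fun r => -f' r / f r ^ 2, ?_, rfl, ?_⟩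
  · filter_upwards [hf', hc.eventually_ne h₀] with r h₁ h₂ using h₁.fun_inv h₂
  · refine (hf''.neg.div (hf'.self_of_nhds.pow 2) (pow_ne_zero 2 h₀)).congr_deriv ?_
    simp
    field_simp
    ring

theorem sqrt (hf : HasTwoJetAt f t a₀ a₁ a₂) (h₀ : 0 < a₀) :
    HasTwoJetAt (fun r => √(f r)) t (√a₀) (a₁ / (2 * √a₀))
      (a₂ / (2 * √a₀) - a₁ ^ 2 / (4 * √a₀ ^ 3)) := by
  have hc := hf.continuousAt
  obtain ⟨rfl, f', hf', rfl, hf''⟩ := hf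
  have hs : √(f t) ≠ 0 := (Real.sqrt_pos.2 h₀).ne'
  refine ⟨rfl, fun r => f' r / (2 * √(f r)), ?_, rfl, ?_⟩
  · filter_upwards [hf', hc.eventually_ne h₀.ne'] with r h₁ h₂ using h₁.sqrt h₂
  · refine (hf''.div ((hf'.self_of_nhds.sqrt h₀.ne').const_mul 2)
      (mul_ne_zero two_ne_zero hs)).congr_deriv ?_
    field_simp
    ring

end HasTwoJetAt

theorem iteratedFDeriv_two_eq_of_hasTwoJetAt {E : Type*} [NormedAddCommGroup E] [NormedSpace ℝ E]
    {f : E → ℝ} {v u : E} {a₀ a₁ a₂ : ℝ} (hf : ContDiffAt ℝ 2 f v)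
    (hjet : HasTwoJetAt (fun t => f (v + t • u)) 0 a₀ a₁ a₂) :
    iteratedFDeriv ℝ 2 f v ![u, u] = a₂ := by
  obtain ⟨-, g, hg, -, hg'⟩ := hjet
  have hline : ∀ t : ℝ, HasDerivAt (fun t : ℝ => v + t • u) u t := fun t => by
    simpa using ((hasDerivAt_id t).smul_const u).const_add v
  have hz : v + (0 : ℝ) • u = v := by simp
  have hdiff : ∀ᶠ x in 𝓝 v, DifferentiableAt ℝ f x :=
    (hf.eventually (by simp)).mono fun x hx => hx.differentiableAt (by simp)
  have hev : g =ᶠ[𝓝 0] fun t => fderiv ℝ f (v + t • u) u := by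
    have ht : Tendsto (fun t : ℝ => v + t • u) (𝓝 0) (𝓝 v) := by
      simpa using (hline 0).continuousAt.tendsto
    filter_upwards [hg, ht.eventually hdiff] with t h₁ h₂
    exact h₁.unique (h₂.hasFDerivAt.comp_hasDerivAt t (hline t))
  have hfd : DifferentiableAt ℝ (fderiv ℝ f) v :=
    (hf.fderiv_right (m := 1) (by norm_num)).differentiableAt (by simp)
  have h₁ : HasDerivAt (fun t : ℝ => fderiv ℝ f (v + t • u)) (fderiv ℝ (fderiv ℝ f) v u) 0 :=
    HasFDerivAt.comp_hasDerivAt 0 (by rw [hz]; exact hfd.hasFDerivAt) (hline 0)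
  have h₂ := h₁.clm_apply (hasDerivAt_const (0 : ℝ) u)
  have h₃ := (hg'.congr_of_eventuallyEq hev.symm).unique h₂
  rw [iteratedFDeriv_two_apply, h₃]
  simp

/-- The second derivative at `0` of `(c / (m - ε w) + h / m + h b / m²)⁻²` along a line, where
`m² = (1 + x t)² μ² + t² W`, `b = (1 + x t) b₀ + t b₁` and `w = (1 + x t) w₀ + t w₁`,
is positive as soon as it is so in the purely radial or the purely transverse direction. -/
theorem hasTwoJetAt_inv_sq_pos {μ W x b₀ b₁ w₀ w₁ c h ε : ℝ} {m b w : ℝ → ℝ}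
    (hμ : 0 < μ) (hδ : 0 < μ - ε * w₀)
    (hQ : 0 < c * (μ - ε * w₀)⁻¹ + h * μ⁻¹ + h * (b₀ * (μ⁻¹ * μ⁻¹)))
    (hm : HasTwoJetAt m 0 μ (x * μ) (W / μ)) (hb : HasTwoJetAt b 0 b₀ (x * b₀ + b₁) 0)
    (hw : HasTwoJetAt w 0 w₀ (x * w₀ + w₁) 0)
    (hS : (x ≠ 0 ∧ W = 0 ∧ b₁ = 0 ∧ w₁ = 0) ∨
      c * (2 * ε ^ 2 * w₁ ^ 2 / (μ - ε * w₀) ^ 3 - W / (μ * (μ - ε * w₀) ^ 2))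
        - h * W / μ ^ 3 - 2 * h * b₀ * W / μ ^ 4 < 0) :
    ∃ a₀ a₁ a₂, 0 < a₂ ∧ HasTwoJetAt (fun t => (c * (m t + -ε * w t)⁻¹ + h * (m t)⁻¹
      + h * (b t * ((m t)⁻¹ * (m t)⁻¹)))⁻¹ * (c * (m t + -ε * w t)⁻¹ + h * (m t)⁻¹
      + h * (b t * ((m t)⁻¹ * (m t)⁻¹)))⁻¹) 0 a₀ a₁ a₂ := by
  have hδ' : μ + -ε * w₀ = μ - ε * w₀ := by ring
  have hmi := hm.inv hμ.ne'
  have hdi := (hm.add (hw.const_mul (-ε))).inv (by rw [hδ']; exact hδ.ne')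
  have hQj := ((hdi.const_mul c).add (hmi.const_mul h)).add ((hb.mul (hmi.mul hmi)).const_mul h)
  set δ := μ - ε * w₀ with hδdef
  set Q := c * δ⁻¹ + h * μ⁻¹ + h * (b₀ * (μ⁻¹ * μ⁻¹)) with hQdef
  set R := c * ε * w₁ / δ ^ 2 + h * b₁ / μ ^ 2 with hR
  set S := c * (2 * ε ^ 2 * w₁ ^ 2 / δ ^ 3 - W / (μ * δ ^ 2))
        - h * W / μ ^ 3 - 2 * h * b₀ * W / μ ^ 4 with hSdef
  have hδ₁ : x * μ + -ε * (x * w₀ + w₁) = x * δ - ε * w₁ := by rw [hδdef]; ring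
  have hδ₂ : W / μ + -ε * 0 = W / μ := by ring
  rw [hδ', hδ₁, hδ₂] at hQj
  clear_value δ
  have hμ0 := hμ.ne'
  have hδ0 := hδ.ne'
  replace hQj := hQj.congr_jet (b₀ := Q) (b₁ := -x * Q + R)
    (b₂ := 2 * x ^ 2 * Q - 4 * x * R + S) rfl
    (by rw [hQdef, hR]; field_simp; ring) (by rw [hQdef, hR, hSdef]; field_simp; ring)
  have hj := (hQj.inv hQ.ne').mul (hQj.inv hQ.ne')
  refine ⟨_, _, _, ?_, hj⟩
  have hQ0 := hQ.ne'
  have key : 0 < (x * Q - R) ^ 2 + (2 * R ^ 2 - Q * S) := by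
    rcases hS with ⟨hx, rfl, rfl, rfl⟩ | hS
    · have hR0 : R = 0 := by rw [hR]; ring
      have hS0 : S = 0 := by rw [hSdef]; ring
      rw [hR0, hS0]
      have := pow_pos (mul_pos (abs_pos.2 hx) hQ) 2
      have e : (|x| * Q) ^ 2 = (x * Q) ^ 2 := by rw [mul_pow, sq_abs, mul_pow]
      nlinarith
    · nlinarith [mul_pos hQ (neg_pos.2 hS), sq_nonneg (x * Q - R), sq_nonneg R]
  have e : ∀ y, y = 2 * ((x * Q - R) ^ 2 + (2 * R ^ 2 - Q * S)) / Q ^ 4 → 0 < y := by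
    rintro y rfl
    positivity
  apply e
  clear_value Q R S
  field_simp
  ring

theorem transverse_second_deriv_neg {a h s ε μ W b w₀ w₁ : ℝ} (ha : 0 < a) (hh : 0 < h)
    (hε : 0 ≤ ε) (hε₁ : 21 * ε < 1) (hε₂ : 21 * a * ε < a + h - 2 * h * s) (hμ : 0 < μ)
    (hW : 0 < W) (hb : -(s * μ) ≤ b) (hw₀ : |w₀| ≤ 2 * μ) (hw₁ : w₁ ^ 2 ≤ 4 * W) :
    a * (1 - ε ^ 2) * (2 * ε ^ 2 * w₁ ^ 2 / (μ - ε * w₀) ^ 3 - W / (μ * (μ - ε * w₀) ^ 2))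
      - h * W / μ ^ 3 - 2 * h * b * W / μ ^ 4 < 0 := by
  obtain ⟨hw₀l, hw₀u⟩ := abs_le.1 hw₀
  obtain ⟨ρ, hρ⟩ : ∃ ρ, μ - ε * w₀ = μ * ρ := ⟨(μ - ε * w₀) / μ, by field_simp⟩
  obtain ⟨β, rfl⟩ : ∃ β, b = μ * β := ⟨b / μ, by field_simp⟩
  have hρl : 1 - 2 * ε ≤ ρ := by
    refine le_of_mul_le_mul_left ?_ hμ
    rw [← hρ]
    nlinarith [mul_le_mul_of_nonneg_left hw₀u hε]
  have hρu : ρ ≤ 1 + 2 * ε := by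
    refine le_of_mul_le_mul_left ?_ hμ
    rw [← hρ]
    nlinarith [mul_le_mul_of_nonneg_left hw₀l hε]
  have hβ : -s ≤ β := by
    refine le_of_mul_le_mul_left ?_ hμ
    linarith
  rw [hρ]
  have hρ0 : 0 < ρ := by linarith
  have h₁ : 1 - 4 * ε ≤ 1 / ρ ^ 2 := by
    rw [le_div_iff₀ (by positivity)]
    have : ρ ^ 2 ≤ (1 + 2 * ε) ^ 2 := by gcongr
    nlinarith [mul_le_mul_of_nonneg_left this (by linarith : 0 ≤ 1 - 4 * ε), pow_nonneg hε 3,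
      pow_nonneg hε 2]
  have h₂ : 1 / ρ ^ 3 ≤ 8 := by
    rw [div_le_iff₀ (by positivity)]
    have : (1 / 2 : ℝ) ^ 3 ≤ ρ ^ 3 := by
      gcongr
      linarith
    linarith
  have hc : 0 < a * (1 - ε ^ 2) := mul_pos ha (by nlinarith)
  have h₃ : 1 - 20 * ε ≤ 1 / ρ ^ 2 - 8 * ε ^ 2 * (1 / ρ ^ 3) := by
    have := mul_le_mul_of_nonneg_left h₂ (by positivity : 0 ≤ 8 * ε ^ 2)
    nlinarith
  have h₄ : a * (1 - 21 * ε) ≤ a * (1 - ε ^ 2) * (1 / ρ ^ 2 - 8 * ε ^ 2 * (1 / ρ ^ 3)) := by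
    refine le_trans ?_ (mul_le_mul_of_nonneg_left h₃ hc.le)
    rw [mul_assoc]
    refine mul_le_mul_of_nonneg_left ?_ ha.le
    nlinarith [pow_nonneg hε 3]
  have h₅ : 2 * ε ^ 2 * w₁ ^ 2 / (μ * ρ) ^ 3 ≤ 2 * ε ^ 2 * (4 * W) / (μ * ρ) ^ 3 := by gcongr
  have h₆ : 0 < W / μ ^ 3 * (a * (1 - ε ^ 2) * (1 / ρ ^ 2 - 8 * ε ^ 2 * (1 / ρ ^ 3))
      + h + 2 * h * β) := by
    refine mul_pos (by positivity) ?_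
    nlinarith [mul_le_mul_of_nonneg_left hβ hh.le]
  calc _ ≤ a * (1 - ε ^ 2) * (2 * ε ^ 2 * (4 * W) / (μ * ρ) ^ 3 - W / (μ * (μ * ρ) ^ 2))
      - h * W / μ ^ 3 - 2 * h * (μ * β) * W / μ ^ 4 := by gcongr
    _ = -(W / μ ^ 3 * (a * (1 - ε ^ 2) * (1 / ρ ^ 2 - 8 * ε ^ 2 * (1 / ρ ^ 3))
      + h + 2 * h * β)) := by
        field_simp
        ring
    _ < 0 := by linarith

/-- Cauchy–Schwarz for the Riemannian metric of the graph with slopes `p`, `q`, applied to the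
first coordinate direction. -/
theorem abs_graph_inner_div_le (p q x y b A : ℝ) (hb : b = x * p + y * q)
    (hA : A = √(x ^ 2 + y ^ 2 + b ^ 2)) : |(x + p * b) / √(1 + p ^ 2)| ≤ A := by
  subst hb hA
  have h₁ : 0 < √(1 + p ^ 2) := Real.sqrt_pos.2 (by positivity)
  rw [abs_div, abs_of_pos h₁, div_le_iff₀ h₁, ← Real.sqrt_mul (by positivity)]
  refine Real.abs_le_sqrt ?_
  nlinarith [sq_nonneg (y * q), sq_nonneg y,
    mul_nonneg (sq_nonneg y) (sq_nonneg p)]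

/-- persistence of the Finsler property for weak wind: if `2s < (a+h)/h`,
then there exists `ε₀ ∈ (0,1)` such that for every `ε ∈ [0, ε₀)` and every `φ̃ ∈ ℝ`, one has
`α v − ε·ω v > 0` and `D v > 0` for all nonzero `v`, and `F_w` (with `F_w 0 = 0`) is a
Minkowski norm on `ℝ²`. -/
theorem wind_metric_minkowski_for_small_eps
    (gx gy a h : ℝ) (ha : 0 < a) (hh : 0 < h)
    (β α : ℝ × ℝ → ℝ) (s : ℝ)
    (hβ : ∀ v : ℝ × ℝ, β v = v.1 * gx + v.2 * gy)
    (hα : ∀ v : ℝ × ℝ, α v = Real.sqrt (v.1 ^ 2 + v.2 ^ 2 + β v ^ 2))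
    (hs : s = Real.sqrt (gx ^ 2 + gy ^ 2) / Real.sqrt (1 + gx ^ 2 + gy ^ 2))
    (hslope : 2 * s < (a + h) / h)
    (ω : ℝ → ℝ × ℝ → ℝ)
    (hω : ∀ φ : ℝ, ∀ v : ℝ × ℝ, ω φ v =
      (v.1 + gx * β v) / Real.sqrt (1 + gx ^ 2) * Real.cos φ +
      (v.2 + gy * β v) / Real.sqrt (1 + gy ^ 2) * Real.sin φ)
    (D : ℝ → ℝ → ℝ × ℝ → ℝ)
    (hD : ∀ ε φ : ℝ, ∀ v : ℝ × ℝ, D ε φ v =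
      α v ^ 2 * a * (1 - ε ^ 2) / (α v - ε * ω φ v) + h * (α v + β v))
    (Fw : ℝ → ℝ → ℝ × ℝ → ℝ)
    (hFw : ∀ ε φ : ℝ, ∀ v : ℝ × ℝ, v ≠ 0 → Fw ε φ v = α v ^ 2 / D ε φ v)
    (hFw0 : ∀ ε φ : ℝ, Fw ε φ 0 = 0) :
    ∃ ε₀ : ℝ, 0 < ε₀ ∧ ε₀ < 1 ∧
      ∀ ε : ℝ, 0 ≤ ε → ε < ε₀ → ∀ φ : ℝ,
        (∀ v : ℝ × ℝ, v ≠ 0 → 0 < α v - ε * ω φ v ∧ 0 < D ε φ v) ∧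
        IsMinkowskiNorm (Fw ε φ) := by
  have h2 : (2 : WithTop ℕ∞) ≤ ((⊤ : ℕ∞) : WithTop ℕ∞) :=
    WithTop.coe_le_coe.2 (le_top : (2 : ℕ∞) ≤ ⊤)
  have hk : 0 < a + h - 2 * h * s := by
    rw [lt_div_iff₀ hh] at hslope
    linarith
  have hq : ∀ v : ℝ × ℝ, v ≠ 0 → 0 < v.1 ^ 2 + v.2 ^ 2 + β v ^ 2 := by
    intro v hv
    by_contra! hle
    refine hv (Prod.ext ?_ ?_)
    · exact pow_eq_zero_iff two_ne_zero |>.1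
        (le_antisymm (by nlinarith [sq_nonneg v.2, sq_nonneg (β v)]) (sq_nonneg _))
    · exact pow_eq_zero_iff two_ne_zero |>.1
        (le_antisymm (by nlinarith [sq_nonneg v.1, sq_nonneg (β v)]) (sq_nonneg _))
  have hαpos : ∀ v : ℝ × ℝ, v ≠ 0 → 0 < α v := fun v hv => by
    rw [hα]
    exact Real.sqrt_pos.2 (hq v hv)
  have hα0 : ∀ v : ℝ × ℝ, 0 ≤ α v := fun v => by
    rw [hα]
    positivity
  have hαsq : ∀ v : ℝ × ℝ, α v ^ 2 = v.1 ^ 2 + v.2 ^ 2 + β v ^ 2 := fun v => by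
    rw [hα, Real.sq_sqrt (by positivity)]
  have hs0 : 0 ≤ s := by
    rw [hs]
    positivity
  have hs1 : s < 1 := by
    rw [hs, div_lt_one (Real.sqrt_pos.2 (by positivity))]
    exact Real.sqrt_lt_sqrt (by positivity) (by linarith)
  have hsβ : ∀ v : ℝ × ℝ, -(s * α v) ≤ β v := by
    intro v
    have hs2 : s ^ 2 * (1 + gx ^ 2 + gy ^ 2) = gx ^ 2 + gy ^ 2 := by
      rw [hs, div_pow, Real.sq_sqrt (by positivity), Real.sq_sqrt (by positivity)]
      field_simp
    have hcs : β v ^ 2 ≤ (s * α v) ^ 2 := by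
      refine le_of_mul_le_mul_left ?_ (by positivity : 0 < 1 + gx ^ 2 + gy ^ 2)
      have e : (1 + gx ^ 2 + gy ^ 2) * (s * α v) ^ 2
          = (gx ^ 2 + gy ^ 2) * (v.1 ^ 2 + v.2 ^ 2 + β v ^ 2) := by
        rw [← hs2, ← hαsq]
        ring
      rw [e, hβ]
      nlinarith [sq_nonneg (v.1 * gy - v.2 * gx)]
    exact (abs_le.1 (abs_le_of_sq_le_sq hcs (mul_nonneg hs0 (hα0 v)))).1
  have hωle : ∀ φ v, |ω φ v| ≤ 2 * α v := by
    intro φ v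
    rw [hω]
    have h₁ := abs_graph_inner_div_le gx gy v.1 v.2 (β v) (α v) (hβ v) (hα v)
    have h₂ := abs_graph_inner_div_le gy gx v.2 v.1 (β v) (α v) (by rw [hβ]; ring)
      (by rw [hα]; ring_nf)
    have h₃ := mul_le_mul h₁ (Real.abs_cos_le_one φ) (abs_nonneg _) (hα0 v)
    have h₄ := mul_le_mul h₂ (Real.abs_sin_le_one φ) (abs_nonneg _) (hα0 v)
    rw [← abs_mul] at h₃ h₄
    linarith [abs_add_le ((v.1 + gx * β v) / √(1 + gx ^ 2) * Real.cos φ)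
      ((v.2 + gy * β v) / √(1 + gy ^ 2) * Real.sin φ)]
  have hβlin : ∀ (v u : ℝ × ℝ) (t : ℝ), β (v + t • u) = β v + t * β u := by
    intro v u t
    simp only [hβ, Prod.fst_add, Prod.snd_add, Prod.smul_fst, Prod.smul_snd, smul_eq_mul]
    ring
  have hωlin : ∀ φ (v u : ℝ × ℝ) (t : ℝ), ω φ (v + t • u) = ω φ v + t * ω φ u := by
    intro φ v u t
    simp only [hω, hβlin, Prod.fst_add, Prod.snd_add, Prod.smul_fst, Prod.smul_snd, smul_eq_mul]
    ring
  refine ⟨min (1 / 21) ((a + h - 2 * h * s) / (21 * a)), by positivity,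
    (min_le_left _ _).trans_lt (by norm_num), fun ε hε hεlt φ => ?_⟩
  have hε₁ : 21 * ε < 1 := by linarith [hεlt.trans_le (min_le_left _ _)]
  have hε₂ : 21 * a * ε < a + h - 2 * h * s := by
    have := hεlt.trans_le (min_le_right _ _)
    rw [lt_div_iff₀ (by positivity)] at this
    linarith
  have hδ : ∀ v : ℝ × ℝ, v ≠ 0 → 0 < α v - ε * ω φ v := by
    intro v hv
    have := mul_le_mul_of_nonneg_left (abs_le.1 (hωle φ v)).2 hε
    nlinarith [hαpos v hv]
  have hc : 0 < a * (1 - ε ^ 2) := mul_pos ha (by nlinarith)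
  have hDge : ∀ v : ℝ × ℝ, v ≠ 0 → h * (1 - s) * α v ≤ D ε φ v := by
    intro v hv
    rw [hD, mul_assoc (α v ^ 2)]
    have h₁ : 0 ≤ α v ^ 2 * (a * (1 - ε ^ 2)) / (α v - ε * ω φ v) := by
      have := hδ v hv
      positivity
    nlinarith [mul_le_mul_of_nonneg_left (hsβ v) hh.le]
  have hDpos : ∀ v : ℝ × ℝ, v ≠ 0 → 0 < D ε φ v := fun v hv =>
    (mul_pos (mul_pos hh (sub_pos.2 hs1)) (hαpos v hv)).trans_le (hDge v hv)
  have hFpos : ∀ v : ℝ × ℝ, v ≠ 0 → 0 < Fw ε φ v := fun v hv => by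
    rw [hFw _ _ v hv]
    exact div_pos (pow_pos (hαpos v hv) 2) (hDpos v hv)
  have hβsmooth : ContDiff ℝ (⊤ : ℕ∞) β := by
    rw [show β = fun v => v.1 * gx + v.2 * gy from funext hβ]
    fun_prop
  have hωsmooth : ContDiff ℝ (⊤ : ℕ∞) (ω φ) := by
    rw [show ω φ = _ from funext (hω φ)]
    fun_prop
  have hsmooth : ∀ v : ℝ × ℝ, v ≠ 0 → ContDiffAt ℝ (⊤ : ℕ∞) (Fw ε φ) v := by
    intro v hv
    have hαs : ContDiffAt ℝ (⊤ : ℕ∞) α v := by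
      rw [show α = _ from funext hα]
      exact ContDiffAt.sqrt (by fun_prop) (hq v hv).ne'
    have hDs : ContDiffAt ℝ (⊤ : ℕ∞) (D ε φ) v := by
      rw [show D ε φ = _ from funext (hD ε φ)]
      have hωs := hωsmooth.contDiffAt (x := v)
      have hβs := hβsmooth.contDiffAt (x := v)
      exact ((((hαs.pow 2).mul contDiffAt_const).mul contDiffAt_const).div
        (hαs.sub (contDiffAt_const.mul hωs)) (hδ v hv).ne').add
        (contDiffAt_const.mul (hαs.add hβs))
    refine ((hαs.pow 2).div hDs (hDpos v hv).ne').congr_of_eventuallyEq ?_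
    filter_upwards [isOpen_ne.mem_nhds hv] with x hx using hFw ε φ x hx
  have hinv : ∀ v : ℝ × ℝ, v ≠ 0 → Fw ε φ v = (a * (1 - ε ^ 2) * (α v + -ε * ω φ v)⁻¹
      + h * (α v)⁻¹ + h * (β v * ((α v)⁻¹ * (α v)⁻¹)))⁻¹ := by
    intro v hv
    rw [hFw _ _ v hv, hD, ← inv_div]
    have h₁ := (hαpos v hv).ne'
    have h₂ := (hδ v hv).ne'
    rw [show α v + -ε * ω φ v = α v - ε * ω φ v by ring]
    congr 1
    field_simp
    ring
  refine ⟨fun v hv => ⟨hδ v hv, hDpos v hv⟩, ?_, ?_, hFpos,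
    fun v hv => (hsmooth v hv).contDiffWithinAt, ?_, fun v hv => ⟨?_, ?_⟩⟩
  · rw [continuous_iff_continuousAt]
    intro v
    rcases eq_or_ne v 0 with rfl | hv
    · have hαc : Tendsto (fun x => (h * (1 - s))⁻¹ * α x) (𝓝 0) (𝓝 0) := by
        have : Continuous fun x => (h * (1 - s))⁻¹ * α x := by
          rw [show α = _ from funext hα]
          have := hβsmooth.continuous
          fun_prop
        simpa [hα, hβ] using this.tendsto 0
      rw [ContinuousAt, hFw0]
      refine squeeze_zero (fun x => ?_) (fun x => ?_) hαc
      · rcases eq_or_ne x 0 with rfl | hx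
        · rw [hFw0]
        · exact (hFpos x hx).le
      · rcases eq_or_ne x 0 with rfl | hx
        · simp [hFw0, hα, hβ]
        · have h₁ := mul_pos (mul_pos hh (sub_pos.2 hs1)) (hαpos x hx)
          have h₂ := hαpos x hx
          have h₃ := sub_pos.2 hs1
          rw [hFw _ _ x hx]
          calc _ ≤ α x ^ 2 / (h * (1 - s) * α x) := by
                gcongr
                exact hDge x hx
            _ = _ := by field_simp
    · exact (hsmooth v hv).continuousAt
  · intro v
    rcases eq_or_ne v 0 with rfl | hv
    · rw [hFw0]
    · exact (hFpos v hv).le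
  · intro lam hlam v
    rcases eq_or_ne v 0 with rfl | hv
    · simp [hFw0]
    · have hβs : β (lam • v) = lam * β v := by
        simp only [hβ, Prod.smul_fst, Prod.smul_snd, smul_eq_mul]
        ring
      have hωs : ω φ (lam • v) = lam * ω φ v := by
        simp only [hω, hβs, Prod.smul_fst, Prod.smul_snd, smul_eq_mul]
        ring
      have hαs : α (lam • v) = lam * α v := by
        rw [← Real.sqrt_sq (hα0 (lam • v)), ← Real.sqrt_sq (mul_nonneg hlam.le (hα0 v)), mul_pow,
          hαsq, hαsq, hβs]
        simp only [Prod.smul_fst, Prod.smul_snd, smul_eq_mul]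
        ring_nf
      have hDs : D ε φ (lam • v) = lam * D ε φ v := by
        have := (hδ v hv).ne'
        rw [hD, hD, hαs, hβs, hωs,
          show lam * α v - ε * (lam * ω φ v) = lam * (α v - ε * ω φ v) by ring]
        field_simp
      have := (hDpos v hv).ne'
      rw [hFw _ _ v hv, hFw _ _ _ (smul_ne_zero hlam.ne' hv), hDs, hαs]
      field_simp
  · intro u w
    have h₁ : IsSymmSndFDerivAt ℝ (fun x => Fw ε φ x ^ 2) v :=
      ((hsmooth v hv).pow 2).isSymmSndFDerivAt (by simpa using h2)
    rw [iteratedFDeriv_two_apply, iteratedFDeriv_two_apply]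
    simpa using h₁ u w
  · intro u hu
    refine mul_pos (by norm_num) ?_
    have hμ := hαpos v hv
    have hμ2 := hαsq v
    set x := (v.1 * u.1 + v.2 * u.2 + β v * β u) / α v ^ 2 with hx
    obtain ⟨w, hw⟩ : ∃ w, w = u - x • v := ⟨_, rfl⟩
    have huw : u = w + x • v := by rw [hw]; abel
    have hxμ : v.1 * u.1 + v.2 * u.2 + β v * β u = x * α v ^ 2 := by
      rw [hx]
      field_simp
    clear_value x
    have horth : v.1 * w.1 + v.2 * w.2 + β v * β w = 0 := by
      have e₁ : u.1 = w.1 + x * v.1 := by rw [huw]; simp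
      have e₂ : u.2 = w.2 + x * v.2 := by rw [huw]; simp
      have e₃ : β u = β w + x * β v := by rw [huw, hβlin]
      rw [e₁, e₂, e₃, hμ2] at hxμ
      linarith
    have hβu : β u = x * β v + β w := by rw [huw, hβlin]; ring
    have hωu : ω φ u = x * ω φ v + ω φ w := by rw [huw, hωlin]; ring
    have hm : HasTwoJetAt (fun t => α (v + t • u)) 0 (α v) (x * α v) (α w ^ 2 / α v) := by
      have e : (fun t : ℝ => α (v + t • u)) = fun t =>
          √(α v ^ 2 + (2 * x * α v ^ 2) * t + (x ^ 2 * α v ^ 2 + α w ^ 2) * t ^ 2) := by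
        funext t
        rw [hα (v + t • u), hβlin, hμ2, hαsq w, huw]
        congr 1
        simp only [hβlin, Prod.fst_add, Prod.snd_add, Prod.smul_fst, Prod.smul_snd, smul_eq_mul]
        linear_combination (2 * t + 2 * x * t ^ 2) * horth
      rw [e]
      refine ((HasTwoJetAt.quadratic _ _ _).sqrt (pow_pos hμ 2)).congr_jet ?_ ?_ ?_ <;>
        rw [Real.sqrt_sq hμ.le]
      · field_simp
      · field_simp
        ring
    have hb : HasTwoJetAt (fun t => β (v + t • u)) 0 (β v) (x * β v + β w) 0 := by
      simp only [hβlin v u]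
      simpa [hβu, mul_comm] using HasTwoJetAt.quadratic (β v) (β u) 0
    have hωj : HasTwoJetAt (fun t => ω φ (v + t • u)) 0 (ω φ v) (x * ω φ v + ω φ w) 0 := by
      simp only [hωlin φ v u]
      simpa [hωu, mul_comm] using HasTwoJetAt.quadratic (ω φ v) (ω φ u) 0
    have hQ := hFpos v hv
    rw [hinv v hv, inv_pos, show α v + -ε * ω φ v = α v - ε * ω φ v by ring] at hQ
    obtain ⟨a₀, a₁, a₂, ha₂, hj⟩ := hasTwoJetAt_inv_sq_pos hμ (hδ v hv) hQ hm hb hωj (by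
      rcases eq_or_ne w 0 with rfl | hw0
      · refine Or.inl ⟨?_, ?_, ?_, ?_⟩
        · rintro rfl
          simp [huw] at hu
        all_goals simp [hα, hβ, hω]
      · refine Or.inr (transverse_second_deriv_neg ha hh hε hε₁ hε₂ hμ
          (pow_pos (hαpos w hw0) 2) (hsβ v) (hωle φ v) ?_)
        rw [← sq_abs]
        calc |ω φ w| ^ 2 ≤ (2 * α w) ^ 2 := by
              gcongr
              exact hωle φ w
          _ = _ := by ring)
    have hf : ContDiffAt ℝ 2 (fun y => Fw ε φ y ^ 2) v :=
      ((hsmooth v hv).pow 2).of_le h2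
    have hev : ∀ᶠ t : ℝ in 𝓝 0, v + t • u ≠ 0 := by
      have : Continuous fun t : ℝ => v + t • u := by fun_prop
      exact this.continuousAt.eventually_ne (by simpa using hv)
    rw [iteratedFDeriv_two_eq_of_hasTwoJetAt hf (hj.congr_of_eventuallyEq (hev.mono fun t ht => by
      simp only [hinv _ ht, sq]))]
    exact ha₂
end

section
/- (Fundamental tensor of the wind-adapted metric; computation in the proof of Theorem 4.1.) Let v ∈ ℝ² be nonzero with α(v) − ε·ω(v) > 0 and D(v) > 0, and let u ∈ ℝ². Then the function δ ↦ F_w(v + δ·u)² is differentiable at δ = 0 and (1/2)·(d/dδ) F_w(v + δ·u)² |_{δ=0} = (α(v)²/D(v)³) · { 2·⟪v,u⟫·D(v) + (a·(1 − ε²)/(α(v) − ε·ω(v))²) · [ ε·α(v)²·( 2·⟪v,u⟫·ω(v) − α(v)²·ω(u) ) − α(v)³·⟪v,u⟫ ] − h·α(v)²·( ⟪v,u⟫/α(v) + β(u) ) }. -/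
/-- The derivative of `δ ↦ (A² / D)²`, where `D = A² c / (A - ε W) + h (A + B)`. -/
theorem hasDerivAt_sq_div_sq {A W B D : ℝ → ℝ} {c h ε x p w b : ℝ}
    (hA : HasDerivAt A (p / A x) x) (hW : HasDerivAt W w x) (hB : HasDerivAt B b x)
    (hD : ∀ t, D t = A t ^ 2 * c / (A t - ε * W t) + h * (A t + B t))
    (hA0 : A x ≠ 0) (hAW : A x - ε * W x ≠ 0) (hD0 : D x ≠ 0) :
    HasDerivAt (fun t => (A t ^ 2 / D t) ^ 2)
      (2 * ((A x ^ 2 / D x ^ 3) *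
        (2 * p * D x
          + (c / (A x - ε * W x) ^ 2) *
              (ε * A x ^ 2 * (2 * p * W x - A x ^ 2 * w) - A x ^ 3 * p)
          - h * A x ^ 2 * (p / A x + b)))) x := by
  have hDd : HasDerivAt D
      ((2 * p * c * (A x - ε * W x) - A x ^ 2 * c * (p / A x - ε * w)) / (A x - ε * W x) ^ 2
        + h * (p / A x + b)) x := by
    rw [funext hD]
    refine ((((hA.fun_pow 2).mul_const c).fun_div (hA.fun_sub (hW.const_mul ε)) hAW).fun_add
      ((hA.fun_add hB).const_mul h)).congr_deriv ?_
    field_simp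
    ring
  refine (((hA.fun_pow 2).fun_div hDd hD0).fun_pow 2).congr_deriv ?_
  generalize D x = d at *
  generalize hs : A x - ε * W x = s at *
  simp only [Nat.cast_ofNat, Nat.add_one_sub_one, pow_one]
  field_simp
  subst hs
  ring

/-- fundamental tensor of the wind-adapted metric: for nonzero `v` with
`α v − ε·ω v > 0` and `D v > 0`, and any `u`, the function `δ ↦ F_w(v + δ·u)²` is
differentiable at `δ = 0` and half its derivative equals the displayed expression. -/
theorem wind_metric_fundamental_tensor_formula
    (gx gy a h ε φ : ℝ) (ha : 0 < a) (hh : 0 < h) (hε0 : 0 ≤ ε) (hε1 : ε < 1)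
    (β α ω D Fw : ℝ × ℝ → ℝ) (ip : ℝ × ℝ → ℝ × ℝ → ℝ)
    (hβ : ∀ v : ℝ × ℝ, β v = v.1 * gx + v.2 * gy)
    (hα : ∀ v : ℝ × ℝ, α v = Real.sqrt (v.1 ^ 2 + v.2 ^ 2 + β v ^ 2))
    (hω : ∀ v : ℝ × ℝ, ω v =
      (v.1 + gx * β v) / Real.sqrt (1 + gx ^ 2) * Real.cos φ +
      (v.2 + gy * β v) / Real.sqrt (1 + gy ^ 2) * Real.sin φ)
    (hD : ∀ v : ℝ × ℝ, D v =
      α v ^ 2 * a * (1 - ε ^ 2) / (α v - ε * ω v) + h * (α v + β v))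
    (hFw : ∀ v : ℝ × ℝ, v ≠ 0 → Fw v = α v ^ 2 / D v)
    (hip : ∀ v u : ℝ × ℝ, ip v u = v.1 * u.1 + v.2 * u.2 + β v * β u)
    (v u : ℝ × ℝ) (hv : v ≠ 0) (hαω : 0 < α v - ε * ω v) (hDv : 0 < D v) :
    DifferentiableAt ℝ (fun δ : ℝ => Fw (v + δ • u) ^ 2) 0 ∧
    (1 / 2 : ℝ) * deriv (fun δ : ℝ => Fw (v + δ • u) ^ 2) 0 =
      (α v ^ 2 / D v ^ 3) *
        (2 * ip v u * D v
          + (a * (1 - ε ^ 2) / (α v - ε * ω v) ^ 2) *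
              (ε * α v ^ 2 * (2 * ip v u * ω v - α v ^ 2 * ω u) - α v ^ 3 * ip v u)
          - h * α v ^ 2 * (ip v u / α v + β u)) := by
  have hβδ (t : ℝ) : β (v + t • u) = β v + t * β u := by
    simp only [hβ, Prod.fst_add, Prod.snd_add, Prod.smul_fst, Prod.smul_snd, smul_eq_mul]
    ring
  have hωδ (t : ℝ) : ω (v + t • u) = ω v + t * ω u := by
    simp only [hω, hβδ, Prod.fst_add, Prod.snd_add, Prod.smul_fst, Prod.smul_snd, smul_eq_mul]
    ring
  have hline (b c : ℝ) : HasDerivAt (fun t : ℝ => b + t * c) c 0 := by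
    simpa using ((hasDerivAt_id (0 : ℝ)).mul_const c).const_add b
  have hv0 : v + (0 : ℝ) • u = v := by simp
  have hpos : 0 < v.1 ^ 2 + v.2 ^ 2 + β v ^ 2 := by
    have : v.1 ≠ 0 ∨ v.2 ≠ 0 := by
      by_contra! hc
      exact hv (Prod.ext hc.1 hc.2)
    rcases this with h1 | h1 <;> positivity
  have hα0 : α v ≠ 0 := by
    rw [hα]
    exact (Real.sqrt_pos.2 hpos).ne'
  have hαd : HasDerivAt (fun t : ℝ => α (v + t • u)) (ip v u / α v) 0 := by
    have hfun : (fun t : ℝ => α (v + t • u)) = fun t : ℝ =>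
        Real.sqrt ((v.1 + t * u.1) ^ 2 + (v.2 + t * u.2) ^ 2 + (β v + t * β u) ^ 2) := by
      funext t
      simp [hα, hβδ]
    rw [hfun]
    refine (((((hline v.1 u.1).fun_pow 2).fun_add ((hline v.2 u.2).fun_pow 2)).fun_add
      ((hline (β v) (β u)).fun_pow 2)).sqrt (by simpa using hpos.ne')).congr_deriv ?_
    rw [hα v] at hα0 ⊢
    rw [hip]
    simp only [zero_mul, add_zero]
    field_simp
    ring
  have hβd : HasDerivAt (fun t : ℝ => β (v + t • u)) (β u) 0 := by
    simpa only [hβδ] using hline (β v) (β u)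
  have hωd : HasDerivAt (fun t : ℝ => ω (v + t • u)) (ω u) 0 := by
    simpa only [hωδ] using hline (ω v) (ω u)
  have hF : HasDerivAt (fun t : ℝ => (α (v + t • u) ^ 2 / D (v + t • u)) ^ 2) _ 0 :=
    hasDerivAt_sq_div_sq (D := fun t : ℝ => D (v + t • u)) (c := a * (1 - ε ^ 2))
      (h := h) (ε := ε) (p := ip v u) (by simpa only [hv0] using hαd) hωd hβd
      (fun t => by simp only [hD, mul_assoc])
      (by simpa only [hv0] using hα0) (by simpa only [hv0] using hαω.ne')
      (by simpa only [hv0] using hDv.ne')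
  have hne : ∀ᶠ t : ℝ in nhds 0, v + t • u ≠ 0 := by
    have hc : Continuous fun t : ℝ => v + t • u := by fun_prop
    exact hc.continuousAt.eventually_ne (by simpa only [hv0] using hv)
  have hFw' := hF.congr_of_eventuallyEq (f₁ := fun t : ℝ => Fw (v + t • u) ^ 2)
    (hne.mono fun t ht => by simp only [hFw _ ht])
  refine ⟨hFw'.differentiableAt, ?_⟩
  rw [hFw'.deriv]
  simp only [hv0]
  ring
end

section
/- (Second equation of the PDE system in Theorem 4.1: reduced orthogonality condition.) Let v ∈ ℝ² be nonzero with α(v) − ε·ω(v) > 0, D(v) > 0 and F_w(v) = 1, and let u ∈ ℝ². Then (d/dδ) F_w(v + δ·u)² |_{δ=0} = 0 if and only if 0 = (a·(1 − ε²)/(α(v) − ε·ω(v))²) · [ ε·( 2·⟪v,u⟫·ω(v) − α(v)²·ω(u) ) − α(v)·⟪v,u⟫ ] + 2·⟪v,u⟫ − h·( ⟪v,u⟫/α(v) + β(u) ). -/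
/-- second equation of the PDE system in Theorem 4.1, reduced orthogonality
condition: for nonzero `v` with `α v − ε·ω v > 0`, `D v > 0` and `F_w v = 1`, and any `u`,
the derivative of `δ ↦ F_w(v + δ·u)²` at `δ = 0` vanishes iff
`0 = (a(1−ε²)/(α v − ε ω v)²)·[ε·(2⟪v,u⟫·ω v − α v²·ω u) − α v·⟪v,u⟫] + 2⟪v,u⟫
   − h·(⟪v,u⟫/α v + β u)`. -/
theorem wind_metric_orthogonality_equation
    (gx gy a h ε φ : ℝ) (ha : 0 < a) (hh : 0 < h) (hε0 : 0 ≤ ε) (hε1 : ε < 1)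
    (β α ω D Fw : ℝ × ℝ → ℝ) (ip : ℝ × ℝ → ℝ × ℝ → ℝ)
    (hβ : ∀ v : ℝ × ℝ, β v = v.1 * gx + v.2 * gy)
    (hα : ∀ v : ℝ × ℝ, α v = Real.sqrt (v.1 ^ 2 + v.2 ^ 2 + β v ^ 2))
    (hω : ∀ v : ℝ × ℝ, ω v =
      (v.1 + gx * β v) / Real.sqrt (1 + gx ^ 2) * Real.cos φ +
      (v.2 + gy * β v) / Real.sqrt (1 + gy ^ 2) * Real.sin φ)
    (hD : ∀ v : ℝ × ℝ, D v =
      α v ^ 2 * a * (1 - ε ^ 2) / (α v - ε * ω v) + h * (α v + β v))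
    (hFw : ∀ v : ℝ × ℝ, v ≠ 0 → Fw v = α v ^ 2 / D v)
    (hip : ∀ v u : ℝ × ℝ, ip v u = v.1 * u.1 + v.2 * u.2 + β v * β u)
    (v u : ℝ × ℝ) (hv : v ≠ 0) (hαω : 0 < α v - ε * ω v) (hDv : 0 < D v)
    (hunit : Fw v = 1) :
    deriv (fun δ : ℝ => Fw (v + δ • u) ^ 2) 0 = 0 ↔
      0 = (a * (1 - ε ^ 2) / (α v - ε * ω v) ^ 2) *
            (ε * (2 * ip v u * ω v - α v ^ 2 * ω u) - α v * ip v u)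
          + 2 * ip v u - h * (ip v u / α v + β u) := by
  have hβ_line : ∀ δ : ℝ, β (v + δ • u) = β v + δ * β u := fun δ => by
    simp only [hβ, Prod.fst_add, Prod.snd_add, Prod.smul_fst, Prod.smul_snd, smul_eq_mul]
    ring
  have hω_line : ∀ δ : ℝ, ω (v + δ • u) = ω v + δ * ω u := fun δ => by
    simp only [hω, hβ_line, Prod.fst_add, Prod.snd_add, Prod.smul_fst, Prod.smul_snd,
      smul_eq_mul]
    ring
  have hα_line : ∀ δ : ℝ,
      α (v + δ • u) = Real.sqrt (ip v v + 2 * δ * ip v u + δ ^ 2 * ip u u) := fun δ => by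
    rw [hα]
    congr 1
    simp only [hip, hβ_line, Prod.fst_add, Prod.snd_add, Prod.smul_fst, Prod.smul_snd,
      smul_eq_mul]
    ring
  have hαv : α v = Real.sqrt (ip v v) := by simpa using hα_line 0
  have hα_sq : α v ^ 2 = D v := by
    rwa [hFw v hv, div_eq_one_iff_eq hDv.ne'] at hunit
  have hα_ne : α v ≠ 0 := fun h0 => hDv.ne (by rw [← hα_sq, h0]; norm_num)
  have hip_ne : ip v v ≠ 0 := fun h0 => hα_ne (by rw [hαv, h0, Real.sqrt_zero])
  have hβ' : HasDerivAt (fun δ : ℝ => β (v + δ • u)) (β u) 0 := by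
    simpa [hβ_line] using ((hasDerivAt_id (0 : ℝ)).mul_const (β u)).const_add (β v)
  have hω' : HasDerivAt (fun δ : ℝ => ω (v + δ • u)) (ω u) 0 := by
    simpa [hω_line] using ((hasDerivAt_id (0 : ℝ)).mul_const (ω u)).const_add (ω v)
  have hα' : HasDerivAt (fun δ : ℝ => α (v + δ • u)) (ip v u / α v) 0 := by
    have hquad : HasDerivAt (fun δ : ℝ => ip v v + 2 * δ * ip v u + δ ^ 2 * ip u u)
        (2 * ip v u) 0 := by
      have := ((((hasDerivAt_id (0 : ℝ)).const_mul 2).mul_const (ip v u)).const_add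
        (ip v v)).add (((hasDerivAt_id (0 : ℝ)).pow 2).mul_const (ip u u))
      exact this.congr_deriv (by simp)
    simp only [hα_line]
    refine (hquad.sqrt (by simpa using hip_ne)).congr_deriv ?_
    simp only [mul_zero, zero_mul, add_zero, ne_eq, OfNat.ofNat_ne_zero, not_false_eq_true,
      zero_pow, ← hαv]
    field_simp
  have hline_zero : v + (0 : ℝ) • u = v := by simp
  have hD' : HasDerivAt (fun δ : ℝ => D (v + δ • u))
      (2 * ip v u - ((a * (1 - ε ^ 2) / (α v - ε * ω v) ^ 2) *
            (ε * (2 * ip v u * ω v - α v ^ 2 * ω u) - α v * ip v u)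
          + 2 * ip v u - h * (ip v u / α v + β u))) 0 := by
    simp only [hD]
    have := ((((hα'.pow 2).mul_const a).mul_const (1 - ε ^ 2)).div
      (hα'.sub (hω'.const_mul ε)) (by simpa using hαω.ne')).add
      ((hα'.add hβ').const_mul h)
    refine this.congr_deriv ?_
    have hne := hαω.ne'
    simp only [Pi.pow_apply, Pi.sub_apply, hline_zero]
    field_simp
    push_cast
    ring
  have hFw_line : (fun δ : ℝ => Fw (v + δ • u) ^ 2) =ᶠ[nhds 0]
      fun δ => (α (v + δ • u) ^ 2 / D (v + δ • u)) ^ 2 := by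
    have hcont : Continuous fun δ : ℝ => v + δ • u := by fun_prop
    filter_upwards [hcont.continuousAt.eventually_ne (by simpa using hv)] with δ hδ
    rw [hFw _ hδ]
  have hFw' := ((hα'.pow 2).div hD' (by simpa using hDv.ne')).pow 2
  rw [hFw_line.deriv_eq]
  have hDne := hDv.ne'
  generalize (a * (1 - ε ^ 2) / (α v - ε * ω v) ^ 2) *
            (ε * (2 * ip v u * ω v - α v ^ 2 * ω u) - α v * ip v u)
          + 2 * ip v u - h * (ip v u / α v + β u) = E at hFw' ⊢
  have hderiv : deriv (fun δ : ℝ => (α (v + δ • u) ^ 2 / D (v + δ • u)) ^ 2) 0 =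
      2 * E / D v := by
    refine hFw'.deriv.trans ?_
    simp only [Pi.pow_apply, Pi.div_apply, hline_zero, ← hα_sq]
    field_simp
    push_cast
    ring
  rw [hderiv, div_eq_zero_iff, or_iff_left hDne, mul_eq_zero_iff_left two_ne_zero, eq_comm]
end
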